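/- There do not exist a real number λ > 0 and matrices C : Matrix (Fin 4) (Fin 3) ℝ and F : Matrix (Fin 3) (Fin 4) ℝ with all entries nonnegative such that C * F = λ • T, where T is the 4×4 noisy-typewriter matrix [[1,1,0,0],[0,1,1,0],[0,0,1,1],[1,0,0,1]]. (Equivalently, the nonnegative rank of T is strictly greater than its ordinary rank 3; hence the noisy-typewriter correlation can be compressed into a ternary quantum channel but not into a ternary classical channel, answering negatively the question left open by Kobayashi et al.) -/

import Mathlib

open Matrix

/-- The fooling-set bound on the nonnegative rank: if a matrix has positive diagonal and no two
distinct indices have both mutual entries positive, then it does not factor through fewer inner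
indices than it has rows by entrywise-nonnegative matrices. -/
theorem card_le_card_of_nonneg_mul_fooling {ι κ : Type*} [Fintype ι] [Fintype κ]
    {C : Matrix ι κ ℝ} {F : Matrix κ ι ℝ}
    (hC : ∀ i k, 0 ≤ C i k) (hF : ∀ k j, 0 ≤ F k j)
    (hdiag : ∀ i, 0 < (C * F) i i)
    (hfool : ∀ i j, 0 < (C * F) i j → 0 < (C * F) j i → i = j) :
    Fintype.card ι ≤ Fintype.card κ := by
  have hpos {i j : ι} (k : κ) (hi : 0 < C i k) (hj : 0 < F k j) : 0 < (C * F) i j :=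
    Finset.sum_pos' (fun l _ => mul_nonneg (hC i l) (hF l j))
      ⟨k, Finset.mem_univ k, mul_pos hi hj⟩
  have hex (i : ι) : ∃ k, 0 < C i k ∧ 0 < F k i := by
    obtain ⟨k, -, hk⟩ := Finset.exists_lt_of_sum_lt (s := Finset.univ) (f := fun _ => (0 : ℝ))
      (g := fun k => C i k * F k i) (by simpa [Matrix.mul_apply] using hdiag i)
    exact ⟨k, pos_of_mul_pos_left hk (hF k i), pos_of_mul_pos_right hk (hC i k)⟩
  choose f hf using hex
  refine Fintype.card_le_of_injective f fun i j hij => hfool i j ?_ ?_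
  · exact hpos (f i) (hf i).1 (hij ▸ (hf j).2)
  · exact hpos (f i) (hij ▸ (hf j).1) (hf i).2

/-- The nonnegative rank of the noisy-typewriter matrix exceeds 3: no positive
multiple of it factorizes as a product of entrywise-nonnegative matrices through
inner dimension 3. Hence the noisy-typewriter correlation cannot be compressed
into a ternary classical channel. -/
theorem noisy_typewriter_no_nonneg_rank_three_factorization :
    ¬ ∃ (lam : ℝ) (C : Matrix (Fin 4) (Fin 3) ℝ) (F : Matrix (Fin 3) (Fin 4) ℝ),
      0 < lam ∧
      (∀ i j, 0 ≤ C i j) ∧ (∀ i j, 0 ≤ F i j) ∧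
      C * F =
        lam • (!![1, 1, 0, 0; 0, 1, 1, 0; 0, 0, 1, 1; 1, 0, 0, 1] :
          Matrix (Fin 4) (Fin 4) ℝ) := by
  rintro ⟨lam, C, F, hlam, hC, hF, h⟩
  have hcard := card_le_card_of_nonneg_mul_fooling hC hF
    (fun i => by rw [h]; fin_cases i <;> simpa using hlam)
    (fun i j => by rw [h]; fin_cases i <;> fin_cases j <;> simp)
  simp at hcard
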